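/- arXiv:1503.05076 — 2 statements merged into one kernel-verified Lean document; each statement's English description precedes it below -/
import Mathlib

section
/- The graph A5 contains the wheel W_5 as an induced subgraph; consequently A5 is not 3-colourable and is not word-representable. -/
/-- Two distinct letters `x` and `y` alternate in the word `w` if, after deleting all
letters other than `x` and `y` from `w`, no two consecutive letters of the resulting
word are equal (i.e. it reads `xyxy...` or `yxyx...`). -/
def Alternates {V : Type*} [DecidableEq V] (w : List V) (x y : V) : Prop :=
  List.Chain' (· ≠ ·) (w.filter fun z => z = x ∨ z = y)

/-- A finite simple graph `G = (V, E)` is word-representable if there is a word over the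
alphabet `V` in which every element of `V` occurs at least once and such that, for all
distinct `x, y ∈ V`, the letters `x` and `y` alternate in the word iff `{x, y} ∈ E`. -/
def WordRepresentable {V : Type*} [DecidableEq V] (G : SimpleGraph V) : Prop :=
  ∃ w : List V, (∀ v : V, v ∈ w) ∧
    ∀ x y : V, x ≠ y → (G.Adj x y ↔ Alternates w x y)

/-- The wheel graph `W_n` on `n + 1` vertices: a cycle on the `n` vertices `Sum.inl i`
(`i : Fin n`), together with one new hub vertex `Sum.inr ()` adjacent to all of them. -/
def wheelGraph (n : ℕ) : SimpleGraph (Fin n ⊕ Unit) :=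
  SimpleGraph.fromRel fun a b =>
    match a, b with
    | Sum.inl i, Sum.inl j => ((i : ℕ) + 1) % n = (j : ℕ)
    | Sum.inl _, Sum.inr _ => True
    | _, _ => False

/-- The simple graph on `V` whose edges are (the unordered versions of) the pairs
occurring in the list `l`. -/
def graphOfList {V : Type*} (l : List (V × V)) : SimpleGraph V :=
  SimpleGraph.fromRel fun a b => (a, b) ∈ l

def edgesA5 : List ((Fin 4 × Fin 3) × (Fin 4 × Fin 3)) :=
  [
    ((0, 1), (1, 1)), ((0, 1), (0, 2)), ((0, 2), (1, 2)), ((1, 0), (2, 0)), ((1, 0), (1, 1)),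
    ((1, 1), (2, 1)), ((1, 2), (2, 2)), ((2, 0), (3, 0)), ((2, 0), (2, 1)), ((2, 1), (3, 1)),
    ((2, 1), (2, 2)), ((2, 2), (3, 2)), ((3, 0), (3, 1)), ((3, 1), (3, 2)), ((2, 1), (3, 0)),
    ((0, 1), (1, 2)), ((0, 1), (2, 2)), ((1, 1), (2, 2)), ((1, 1), (2, 0)), ((2, 2), (3, 1))]

/-- The graph `A5` from the paper, with vertex set
`{(x,y) : 0 ≤ x ≤ 3, 0 ≤ y ≤ 2} \ {(0, 0)}`. -/
def graphA5 : SimpleGraph {p : Fin 4 × Fin 3 | p ≠ (0, 0)} :=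
  (graphOfList edgesA5).induce {p : Fin 4 × Fin 3 | p ≠ (0, 0)}

theorem chain_iff_aux {V : Type*} [DecidableEq V] (w : List V) : ∀ (x y : V), x ≠ y →
    (List.IsChain (· ≠ ·) (y :: w.filter fun z => z = x ∨ z = y) ↔
      ∀ n, (w.take n).count y ≤ (w.take n).count x ∧
        (w.take n).count x ≤ (w.take n).count y + 1) := by
  induction w with
  | nil => intro x y h; simp
  | cons a w ih =>
    intro x y h
    by_cases hx : a = x
    · subst hx
      have e : (w.filter fun z => decide (z = a ∨ z = y)) =
          w.filter fun z => decide (z = y ∨ z = a) := by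
        congr 1; funext z; simp [or_comm]
      rw [List.filter_cons_of_pos (by simp), List.isChain_cons_cons, e, ih y a h.symm]
      constructor
      · rintro ⟨_, H⟩ n
        cases n with
        | zero => simp
        | succ n =>
          have := H n
          simp [h]
          omega
      · intro H
        refine ⟨h.symm, fun n => ?_⟩
        have := H (n + 1)
        simp [h] at this
        omega
    · by_cases hy : a = y
      · subst hy
        rw [List.filter_cons_of_pos (by simp), List.isChain_cons_cons]
        constructor
        · rintro ⟨h1, _⟩
          exact absurd rfl h1
        · intro H
          have := H 1
          simp [hx] at this
      · rw [List.filter_cons_of_neg (by simp [hx, hy]), ih x y h]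
        constructor
        · intro H n
          cases n with
          | zero => simp
          | succ n =>
            have := H n
            simp [hx, hy]
            omega
        · intro H n
          have := H (n + 1)
          simp [hx, hy] at this
          omega

theorem alternates_iff_aux {V : Type*} [DecidableEq V] (w : List V) (x y : V) (h : x ≠ y) :
    Alternates w x y ↔
      (∀ n, (w.take n).count y ≤ (w.take n).count x ∧
        (w.take n).count x ≤ (w.take n).count y + 1) ∨
      (∀ n, (w.take n).count x ≤ (w.take n).count y ∧
        (w.take n).count y ≤ (w.take n).count x + 1) := by
  rw [← chain_iff_aux w x y h, ← chain_iff_aux w y x h.symm]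
  have e : (w.filter fun z => decide (z = y ∨ z = x)) =
      w.filter fun z => decide (z = x ∨ z = y) := by
    congr 1; funext z; simp [or_comm]
  rw [e]
  unfold Alternates
  have hm : ∀ z ∈ (w.filter fun z => decide (z = x ∨ z = y)), z = x ∨ z = y := by
    intro z hz
    simpa using (List.mem_filter.1 hz).2
  change List.IsChain _ _ ↔ _
  generalize (w.filter fun z => decide (z = x ∨ z = y)) = l at hm
  cases l with
  | nil => simp
  | cons a l =>
    rw [List.isChain_cons_cons, List.isChain_cons_cons]
    rcases hm a (by simp) with rfl | rfl
    · simp [h.symm]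
    · simp [h]

theorem wheel_preorder_aux {V : Type*} [DecidableEq V] (w : List V) (h : V) :
    ∃ d : V → ℕ → ℕ, ∀ u v, u ≠ v → h ≠ u → h ≠ v → Alternates w h u → Alternates w h v →
      (Alternates w u v ↔ (∀ n, d u n ≤ d v n) ∨ (∀ n, d v n ≤ d u n)) := by
  classical
  let L : V → Prop := fun v => ∀ n, (w.take n).count h ≤ (w.take n).count v ∧
        (w.take n).count v ≤ (w.take n).count h + 1
  refine ⟨fun v n => (if L v then 0 else 1) + (w.take n).count v, ?_⟩
  have key : ∀ v, h ≠ v → Alternates w h v →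
      ∀ n, (w.take n).count h ≤ (if L v then 0 else 1) + (w.take n).count v ∧
        (if L v then 0 else 1) + (w.take n).count v ≤ (w.take n).count h + 1 := by
    intro v hv ha n
    by_cases hL : L v
    · simpa [hL] using hL n
    · rcases (alternates_iff_aux w h v hv).1 ha with H | H
      · have := H n
        simp only [hL, if_false]
        omega
      · exact absurd H hL
  intro u v huv hu hv hau hav
  have ku := key u hu hau
  have kv := key v hv hav
  rw [alternates_iff_aux w u v huv]
  dsimp only
  have su : (if L u then 0 else 1) ≤ 1 := by split_ifs <;> omega
  have sv : (if L v then 0 else 1) ≤ 1 := by split_ifs <;> omega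
  generalize (if L u then 0 else 1) = a at *
  generalize (if L v then 0 else 1) = b at *
  constructor
  · intro H
    rcases Nat.lt_trichotomy a b with hab | hab | hab
    · left
      intro n
      have := ku n
      have := kv n
      rcases H with H | H <;> have := H n <;> omega
    · rcases H with H | H
      · right; intro n; have := H n; omega
      · left; intro n; have := H n; omega
    · right
      intro n
      have := ku n
      have := kv n
      rcases H with H | H <;> have := H n <;> omega
  · rintro (H | H) <;> rcases eq_or_ne a b with hab | hab
    · right
      intro n
      have h0 := H 0
      have := H n
      have := ku n
      have := kv n
      simp at h0
      omega
    · left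
      intro n
      have h0 := H 0
      have := H n
      have := ku n
      have := kv n
      simp at h0
      omega
    · left
      intro n
      have h0 := H 0
      have := H n
      have := ku n
      have := kv n
      simp at h0
      omega
    · right
      intro n
      have h0 := H 0
      have := H n
      have := ku n
      have := kv n
      simp at h0
      omega

theorem wheel_not_wordRepresentable_aux {V : Type*} [DecidableEq V] (G : SimpleGraph V)
    (f : wheelGraph 5 ↪g G) : ¬ WordRepresentable G := by
  rintro ⟨w, -, hw⟩
  obtain ⟨d, hd⟩ := wheel_preorder_aux w (f (Sum.inr ()))
  have hub : ∀ i : Fin 5, Alternates w (f (Sum.inr ())) (f (Sum.inl i)) := by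
    intro i
    rw [← hw _ _ (by simp), f.map_adj_iff]
    simp [wheelGraph]
  have hr : ∀ i j : Fin 5, i ≠ j → ((wheelGraph 5).Adj (Sum.inl i) (Sum.inl j) ↔
      (∀ n, d (f (Sum.inl i)) n ≤ d (f (Sum.inl j)) n) ∨
      (∀ n, d (f (Sum.inl j)) n ≤ d (f (Sum.inl i)) n)) := by
    intro i j hij
    have hne : f (Sum.inl i) ≠ f (Sum.inl j) := by simpa using hij
    rw [← hd _ _ hne (by simp) (by simp) (hub i) (hub j), ← hw _ _ hne, f.map_adj_iff]
  obtain ⟨r, hrdef⟩ : ∃ r : Fin 5 → Fin 5 → Prop, ∀ i j, r i j ↔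
      (∀ n, d (f (Sum.inl i)) n ≤ d (f (Sum.inl j)) n) := ⟨_, fun _ _ => Iff.rfl⟩
  have tr : ∀ i j k, r i j → r j k → r i k := by
    intro i j k h1 h2
    rw [hrdef] at *
    exact fun n => (h1 n).trans (h2 n)
  simp only [← hrdef] at hr
  have a01 := (hr 0 1 (by decide)).1 (by simp [wheelGraph])
  have a12 := (hr 1 2 (by decide)).1 (by simp [wheelGraph])
  have a23 := (hr 2 3 (by decide)).1 (by simp [wheelGraph])
  have a34 := (hr 3 4 (by decide)).1 (by simp [wheelGraph])
  have a40 := (hr 4 0 (by decide)).1 (by simp [wheelGraph])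
  have n02 := fun h => (by simp [wheelGraph] : ¬ (wheelGraph 5).Adj (Sum.inl 0) (Sum.inl 2))
    ((hr 0 2 (by decide)).2 h)
  have n13 := fun h => (by simp [wheelGraph] : ¬ (wheelGraph 5).Adj (Sum.inl 1) (Sum.inl 3))
    ((hr 1 3 (by decide)).2 h)
  have n24 := fun h => (by simp [wheelGraph] : ¬ (wheelGraph 5).Adj (Sum.inl 2) (Sum.inl 4))
    ((hr 2 4 (by decide)).2 h)
  have n30 := fun h => (by simp [wheelGraph] : ¬ (wheelGraph 5).Adj (Sum.inl 3) (Sum.inl 0))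
    ((hr 3 0 (by decide)).2 h)
  have n41 := fun h => (by simp [wheelGraph] : ¬ (wheelGraph 5).Adj (Sum.inl 4) (Sum.inl 1))
    ((hr 4 1 (by decide)).2 h)
  have t1 := tr 0 1 2
  have t2 := tr 2 1 0
  have t3 := tr 1 2 3
  have t4 := tr 3 2 1
  have t5 := tr 2 3 4
  have t6 := tr 4 3 2
  have t7 := tr 3 4 0
  have t8 := tr 0 4 3
  have t9 := tr 4 0 1
  have t10 := tr 1 0 4
  clear tr hr hd hub hw hrdef
  grind

theorem wheel_not_colorable_aux : ¬ (wheelGraph 5).Colorable 3 := by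
  rintro ⟨c⟩
  have h : ∀ i : Fin 5, c (Sum.inl i) ≠ c (Sum.inr ()) := fun i => c.valid (by simp [wheelGraph])
  have a01 : c (Sum.inl 0) ≠ c (Sum.inl 1) := c.valid (by simp [wheelGraph])
  have a12 : c (Sum.inl 1) ≠ c (Sum.inl 2) := c.valid (by simp [wheelGraph])
  have a23 : c (Sum.inl 2) ≠ c (Sum.inl 3) := c.valid (by simp [wheelGraph])
  have a34 : c (Sum.inl 3) ≠ c (Sum.inl 4) := c.valid (by simp [wheelGraph])
  have a40 : c (Sum.inl 4) ≠ c (Sum.inl 0) := c.valid (by simp [wheelGraph])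
  have h0 := h 0
  have h1 := h 1
  have h2 := h 2
  have h3 := h 3
  have h4 := h 4
  omega

def wheelVertA5 : Fin 5 ⊕ Unit → {p : Fin 4 × Fin 3 | p ≠ (0, 0)}
  | Sum.inl i => (![⟨(1, 1), by simp⟩, ⟨(2, 0), by simp⟩, ⟨(3, 0), by simp⟩, ⟨(3, 1), by simp⟩,
      ⟨(2, 2), by simp⟩] : Fin 5 → {p : Fin 4 × Fin 3 | p ≠ (0, 0)}) i
  | Sum.inr _ => ⟨(2, 1), by simp⟩

theorem wheel_embeds_aux : Nonempty (wheelGraph 5 ↪g graphA5) := by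
  refine ⟨⟨⟨wheelVertA5, ?_⟩, ?_⟩⟩
  · rintro (i | _) (j | _) h <;> revert h
    · revert i j; decide
    · decide +revert
    · decide +revert
    · simp
  · intro a b
    change graphA5.Adj (wheelVertA5 a) (wheelVertA5 b) ↔ _
    rcases a with i | _ <;> rcases b with j | _
    · fin_cases i <;> fin_cases j <;>
        simp [wheelGraph, graphA5, graphOfList, edgesA5, wheelVertA5]
    · fin_cases i <;> simp [wheelGraph, graphA5, graphOfList, edgesA5, wheelVertA5]
    · fin_cases j <;> simp [wheelGraph, graphA5, graphOfList, edgesA5, wheelVertA5]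
    · simp

/-- The graph `A5` contains the wheel `W_5` as an induced subgraph; consequently `A5`
is not 3-colourable and is not word-representable. -/
theorem graphA5_wheel5_not_colorable_not_wordRepresentable :
    Nonempty (wheelGraph 5 ↪g graphA5) ∧
      ¬ graphA5.Colorable 3 ∧ ¬ WordRepresentable graphA5 := by
  refine ⟨wheel_embeds_aux, ?_, ?_⟩
  · intro h
    obtain ⟨f⟩ := wheel_embeds_aux
    obtain ⟨c⟩ := h
    exact wheel_not_colorable_aux ⟨c.comp f.toHom⟩
  · obtain ⟨f⟩ := wheel_embeds_aux
    exact wheel_not_wordRepresentable_aux _ f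
end

section
/- The graph A6 contains the wheel W_7 as an induced subgraph; consequently A6 is not 3-colourable and is not word-representable. -/
def edgesA6 : List ((Fin 4 × Fin 3) × (Fin 4 × Fin 3)) :=
  [
    ((0, 1), (1, 1)), ((0, 1), (0, 2)), ((0, 2), (1, 2)), ((1, 0), (2, 0)), ((1, 0), (1, 1)),
    ((1, 1), (2, 1)), ((1, 2), (2, 2)), ((2, 0), (3, 0)), ((2, 0), (2, 1)), ((2, 1), (3, 1)),
    ((2, 1), (2, 2)), ((2, 2), (3, 2)), ((3, 0), (3, 1)), ((3, 1), (3, 2)), ((2, 1), (3, 0)),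
    ((0, 2), (1, 1)), ((0, 2), (2, 1)), ((1, 2), (2, 1)), ((1, 1), (2, 0)), ((2, 2), (3, 1))]

/-- The graph `A6` from the paper, with vertex set
`{(x,y) : 0 ≤ x ≤ 3, 0 ≤ y ≤ 2} \ {(0, 0)}`. -/
def graphA6 : SimpleGraph {p : Fin 4 × Fin 3 | p ≠ (0, 0)} :=
  (graphOfList edgesA6).induce {p : Fin 4 × Fin 3 | p ≠ (0, 0)}

def Lead {V : Type*} [DecidableEq V] (w : List V) (x y : V) : Prop :=
  ∀ n : ℕ, 0 ≤ ((w.take n).count x : ℤ) - (w.take n).count y ∧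
    ((w.take n).count x : ℤ) - (w.take n).count y ≤ 1

theorem lead_iff {V : Type*} [DecidableEq V] (w : List V) : ∀ (x y : V), x ≠ y →
    (List.IsChain (· ≠ ·) (y :: w.filter fun z => z = x ∨ z = y) ↔ Lead w x y) := by
  induction w with
  | nil => intro x y _; simp [Lead]
  | cons a w ih =>
    intro x y hxy
    by_cases hx : a = x
    · subst hx
      have hf : (fun z => decide (z = a ∨ z = y)) = fun z => decide (z = y ∨ z = a) := by
        funext z; simp only [or_comm]
      have h1 := ih y a hxy.symm
      rw [← hf] at h1
      simp only [List.filter_cons, true_or, decide_true, if_true, List.isChain_cons_cons, h1]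
      constructor
      · rintro ⟨_, h⟩ n
        cases n with
        | zero => simp
        | succ n =>
          have := h n
          simp [List.take_succ_cons, hxy]
          omega
      · intro h
        refine ⟨hxy.symm, fun n => ?_⟩
        have := h (n+1)
        simp [List.take_succ_cons, hxy] at this
        omega
    · by_cases hy : a = y
      · subst hy
        simp only [List.filter_cons, or_true, decide_true, if_true, List.isChain_cons_cons]
        constructor
        · rintro ⟨h, _⟩; exact absurd rfl h
        · intro h
          have := h 1
          simp [hx] at this
      · have h1 := ih x y hxy
        simp only [List.filter_cons, hx, hy, or_self, decide_false]
        rw [if_neg (by simp), h1]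
        constructor
        · intro h n
          cases n with
          | zero => simp
          | succ n =>
            have := h n
            simp [List.take_succ_cons, hx, hy]
            omega
        · intro h n
          have := h (n+1)
          simp [List.take_succ_cons, hx, hy] at this
          omega

theorem alternates_iff {V : Type*} [DecidableEq V] (w : List V) (x y : V) (hxy : x ≠ y) :
    Alternates w x y ↔ Lead w x y ∨ Lead w y x := by
  have hf : (fun z => decide (z = y ∨ z = x)) = fun z => decide (z = x ∨ z = y) := by
    funext z; simp only [or_comm]
  rw [← lead_iff w x y hxy, ← lead_iff w y x hxy.symm, hf]
  change List.IsChain _ _ ↔ _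
  generalize w.filter _ = l
  cases l with
  | nil => simp
  | cons a l =>
    simp only [List.isChain_cons_cons]
    grind

/-- `h`-relative orientation. -/
def Dir {V : Type*} [DecidableEq V] (w : List V) (s : V → ℤ) (x y : V) : Prop :=
  ∀ n : ℕ, 0 ≤ (((w.take n).count x : ℤ) - s x) - ((w.take n).count y - s y) ∧
    (((w.take n).count x : ℤ) - s x) - ((w.take n).count y - s y) ≤ 1

def Bd {V : Type*} [DecidableEq V] (w : List V) (h x : V) (s : ℤ) : Prop :=
  ∀ n : ℕ, -1 ≤ ((w.take n).count x : ℤ) - s - (w.take n).count h ∧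
    ((w.take n).count x : ℤ) - s - (w.take n).count h ≤ 0

theorem exists_bd {V : Type*} [DecidableEq V] (w : List V) (h x : V) (hx : h ≠ x)
    (ha : Alternates w h x) : ∃ s, Bd w h x s := by
  rcases (alternates_iff w h x hx).1 ha with H | H
  · exact ⟨0, fun n => by have := H n; omega⟩
  · exact ⟨1, fun n => by have := H n; omega⟩

theorem bd_s {V : Type*} [DecidableEq V] {w : List V} {h x : V} {s : ℤ} (H : Bd w h x s) :
    s = 0 ∨ s = 1 := by
  have := H 0
  simp at this
  omega

theorem dir_of_alt {V : Type*} [DecidableEq V] {w : List V} {h x y : V} {s : V → ℤ}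
    (hx : Bd w h x (s x)) (hy : Bd w h y (s y)) (hxy : x ≠ y) (ha : Alternates w x y) :
    Dir w s x y ∨ Dir w s y x := by
  rcases (alternates_iff w x y hxy).1 ha with H | H <;>
  rcases bd_s hx with h1 | h1 <;> rcases bd_s hy with h2 | h2 <;>
  first
  | exact Or.inl fun n => by have := H n; have := hx n; have := hy n; omega
  | exact Or.inr fun n => by have := H n; have := hx n; have := hy n; omega

theorem alt_of_dir {V : Type*} [DecidableEq V] {w : List V} {h x y z : V} {s : V → ℤ}
    (hx : Bd w h x (s x)) (hz : Bd w h z (s z)) (hxz : x ≠ z)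
    (h1 : Dir w s x y) (h2 : Dir w s y z) : Alternates w x z := by
  rw [alternates_iff w x z hxz]
  have key : ∀ n : ℕ, 0 ≤ (((w.take n).count x : ℤ) - s x) - ((w.take n).count z - s z) ∧
    (((w.take n).count x : ℤ) - s x) - ((w.take n).count z - s z) ≤ 1 := fun n => by
    have := h1 n; have := h2 n; have := hx n; have := hz n; omega
  have k0 := key 0
  simp at k0
  rcases bd_s hx with e1 | e1 <;> rcases bd_s hz with e2 | e2 <;>
  first
  | omega
  | exact Or.inl fun n => by have := key n; omega
  | exact Or.inr fun n => by have := key n; omega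

theorem wheel7_not_wr {V : Type*} [DecidableEq V] (G : SimpleGraph V) (e : wheelGraph 7 ↪g G) :
    ¬ WordRepresentable G := by
  rintro ⟨w, -, hw⟩
  have hne : ∀ a b, a ≠ b → e a ≠ e b := fun a b h h' => h (e.injective h')
  have hal : ∀ a b, a ≠ b → ((wheelGraph 7).Adj a b ↔ Alternates w (e a) (e b)) := fun a b h => by
    rw [← hw _ _ (hne a b h), e.map_adj_iff]
  have hb : ∀ i : Fin 7, ∃ s, Bd w (e (Sum.inr ())) (e (Sum.inl i)) s := fun i =>
    exists_bd _ _ _ (hne _ _ (by simp)) ((hal _ _ (by simp)).1 (by simp [wheelGraph]))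
  choose t ht using hb
  obtain ⟨s, hs⟩ : ∃ s : V → ℤ, ∀ i, s (e (Sum.inl i)) = t i :=
    ⟨Function.extend (fun i => e (Sum.inl i)) t 0, fun i =>
      Function.Injective.extend_apply (fun a b h => Sum.inl_injective (e.injective h)) _ _ i⟩
  simp only [← hs] at ht
  have h1 : ∀ i : Fin 7, Dir w s (e (Sum.inl i)) (e (Sum.inl (i+1))) ∨
      Dir w s (e (Sum.inl (i+1))) (e (Sum.inl i)) := fun i => by
    have hi : (Sum.inl i : Fin 7 ⊕ Unit) ≠ Sum.inl (i+1) := by revert i; decide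
    refine dir_of_alt (ht _) (ht _) (hne _ _ hi) ((hal _ _ hi).1 ?_)
    simp only [wheelGraph, SimpleGraph.fromRel_adj]
    clear hi
    revert i; decide
  have h2 : ∀ i : Fin 7, ¬ Alternates w (e (Sum.inl i)) (e (Sum.inl (i+1+1))) ∧
      ¬ Alternates w (e (Sum.inl (i+1+1))) (e (Sum.inl i)) := fun i => by
    have hi : (Sum.inl i : Fin 7 ⊕ Unit) ≠ Sum.inl (i+1+1) := by revert i; decide
    rw [← hal _ _ hi, ← hal _ _ hi.symm]
    simp only [wheelGraph, SimpleGraph.fromRel_adj]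
    clear hi
    revert i; decide
  have h3 : ∀ i : Fin 7, ¬ (Dir w s (e (Sum.inl i)) (e (Sum.inl (i+1))) ∧
      Dir w s (e (Sum.inl (i+1))) (e (Sum.inl (i+1+1)))) := fun i h =>
    (h2 i).1 (alt_of_dir (ht _) (ht _) (hne _ _ (by clear h; revert i; decide)) h.1 h.2)
  have h4 : ∀ i : Fin 7, ¬ (Dir w s (e (Sum.inl (i+1+1))) (e (Sum.inl (i+1))) ∧
      Dir w s (e (Sum.inl (i+1))) (e (Sum.inl i))) := fun i h =>
    (h2 i).2 (alt_of_dir (ht _) (ht _) (hne _ _ (by clear h; revert i; decide)) h.1 h.2)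
  generalize hP : (fun i : Fin 7 => Dir w s (e (Sum.inl i)) (e (Sum.inl (i+1)))) = P
  generalize hQ : (fun i : Fin 7 => Dir w s (e (Sum.inl (i+1))) (e (Sum.inl i))) = Q
  have a1 : ∀ i, P i ∨ Q i := by subst hP hQ; exact h1
  have a2 : ∀ i, ¬ (P i ∧ P (i+1)) := by subst hP; exact h3
  have a3 : ∀ i, ¬ (Q (i+1) ∧ Q i) := by subst hQ; exact h4
  have b1 := a1 0
  have step : ∀ i, (P i → P (i+1+1)) := fun i hi => by
    have := a1 (i+1); have := a1 (i+1+1); have := a2 i; have := a3 (i+1); tauto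
  have stepQ : ∀ i, (Q i → Q (i+1+1)) := fun i hi => by
    have := a1 (i+1); have := a1 (i+1+1); have := a3 i; have := a2 (i+1); tauto
  rcases a1 0 with h | h
  · exact a2 6 ⟨step 4 (step 2 (step 0 h)), h⟩
  · exact a3 6 ⟨h, stepQ 4 (stepQ 2 (stepQ 0 h))⟩

theorem wheel7_not_col : ¬ (wheelGraph 7).Colorable 3 := by
  rintro ⟨c⟩
  have hh : ∀ i, c (Sum.inr ()) ≠ c (Sum.inl i) := fun i => c.valid (by simp [wheelGraph])
  have hc : ∀ i : Fin 7, c (Sum.inl i) ≠ c (Sum.inl (i+1)) := fun i => c.valid (by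
    simp only [wheelGraph, SimpleGraph.fromRel_adj]
    revert i; decide)
  have step : ∀ i : Fin 7, c (Sum.inl i) = c (Sum.inl (i+1+1)) := fun i => by
    have := hh i; have := hh (i+1); have := hh (i+1+1); have := hc i; have := hc (i+1)
    omega
  have := step 0
  have := step 2
  have := step 4
  exact hc 6 (((step 0).trans ((step 2).trans (step 4))).symm)

def wmap : Fin 7 ⊕ Unit → {p : Fin 4 × Fin 3 | p ≠ (0, 0)}
  | Sum.inl i => ![⟨(1,1), by decide⟩, ⟨(2,0), by decide⟩, ⟨(3,0), by decide⟩, ⟨(3,1), by decide⟩,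
      ⟨(2,2), by decide⟩, ⟨(1,2), by decide⟩, ⟨(0,2), by decide⟩] i
  | Sum.inr _ => ⟨(2,1), by decide⟩

theorem wmap_inj : ∀ a b, (wmap a).1 = (wmap b).1 → a = b := by decide

theorem wmap_adj (a b) : graphA6.Adj (wmap a) (wmap b) ↔ (wheelGraph 7).Adj a b := by
  simp only [graphA6, graphOfList, SimpleGraph.comap_adj, wheelGraph, SimpleGraph.fromRel_adj,
    Function.Embedding.subtype_apply]
  rcases a with a | a <;> rcases b with b | b <;> revert a b <;> decide +kernel

def wemb : wheelGraph 7 ↪g graphA6 where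
  toFun := wmap
  inj' := fun a b h => wmap_inj a b (congrArg Subtype.val h)
  map_rel_iff' := fun {a b} => wmap_adj a b

/-- The graph `A6` contains the wheel `W_7` as an induced subgraph; consequently `A6`
is not 3-colourable and is not word-representable. -/
theorem graphA6_wheel7_not_colorable_not_wordRepresentable :
    Nonempty (wheelGraph 7 ↪g graphA6) ∧
      ¬ graphA6.Colorable 3 ∧ ¬ WordRepresentable graphA6 := by
  exact ⟨⟨wemb⟩, fun h => wheel7_not_col (h.of_hom wemb.toHom),
    wheel7_not_wr graphA6 wemb⟩
end
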